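/- Energy identity for the mapped residuals: along any solution of the continuous-time EnKF flow with y = A u†, for each j the squared weighted norm of the mapped residual satisfies (1/2) d/dt ‖A r^{(j)}(t)‖_Γ² = −(1/J) Σ_{r=1}^J ⟨A r^{(j)}(t), A e^{(r)}(t)⟩_Γ²; in particular t ↦ ‖A r^{(j)}(t)‖_Γ is nonincreasing. -/

import Mathlib

open scoped BigOperators
open RealInnerProductSpace Matrix

noncomputable section

/-- The Γ-weighted inner product `⟨a,b⟩_Γ = ⟨Γ⁻¹ a, b⟩` on `ℝ^K`. -/
def gInner {K : ℕ} (Γ : Matrix (Fin K) (Fin K) ℝ)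
    (a b : EuclideanSpace ℝ (Fin K)) : ℝ :=
  ⟪Matrix.toEuclideanLin Γ⁻¹ a, b⟫

/-- Ensemble mean. -/
def ensMean {X : Type*} [AddCommGroup X] [Module ℝ X] {J : ℕ} (v : Fin J → X) : X :=
  (J : ℝ)⁻¹ • ∑ j, v j

/-- Right-hand side of the continuous-time EnKF flow. -/
def enkfRHS {X : Type*} [NormedAddCommGroup X] [InnerProductSpace ℝ X] {K J : ℕ}
    (A : X →L[ℝ] EuclideanSpace ℝ (Fin K)) (Γ : Matrix (Fin K) (Fin K) ℝ)
    (y : EuclideanSpace ℝ (Fin K)) (v : Fin J → X) (j : Fin J) : X :=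
  (J : ℝ)⁻¹ • ∑ k, gInner Γ (A (v k - ensMean v)) (y - A (v j)) • (v k - ensMean v)

/-- `u : ℝ → Fin J → X` solves the continuous-time EnKF flow on `[0,∞)`. -/
def IsEnKFSolution {X : Type*} [NormedAddCommGroup X] [InnerProductSpace ℝ X] {K J : ℕ}
    (A : X →L[ℝ] EuclideanSpace ℝ (Fin K)) (Γ : Matrix (Fin K) (Fin K) ℝ)
    (y : EuclideanSpace ℝ (Fin K)) (u : ℝ → Fin J → X) : Prop :=
  ∀ j : Fin J, ∀ t ∈ Set.Ici (0 : ℝ),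
    HasDerivWithinAt (fun s => u s j) (enkfRHS A Γ y (u t) j) (Set.Ici 0) t

/-- The deviation Gram matrix `E` of an ensemble. -/
def matE {X : Type*} [NormedAddCommGroup X] [InnerProductSpace ℝ X] {K J : ℕ}
    (A : X →L[ℝ] EuclideanSpace ℝ (Fin K)) (Γ : Matrix (Fin K) (Fin K) ℝ)
    (v : Fin J → X) : Matrix (Fin J) (Fin J) ℝ :=
  Matrix.of fun l j => gInner Γ (A (v l - ensMean v)) (A (v j - ensMean v))

/-- The residual/deviation cross Gram matrix `F` of an ensemble. -/
def matF {X : Type*} [NormedAddCommGroup X] [InnerProductSpace ℝ X] {K J : ℕ}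
    (A : X →L[ℝ] EuclideanSpace ℝ (Fin K)) (Γ : Matrix (Fin K) (Fin K) ℝ)
    (udag : X) (v : Fin J → X) : Matrix (Fin J) (Fin J) ℝ :=
  Matrix.of fun l j => gInner Γ (A (v l - udag)) (A (v j - ensMean v))

/-- The residual Gram matrix `R` of an ensemble. -/
def matR {X : Type*} [NormedAddCommGroup X] [InnerProductSpace ℝ X] {K J : ℕ}
    (A : X →L[ℝ] EuclideanSpace ℝ (Fin K)) (Γ : Matrix (Fin K) (Fin K) ℝ)
    (udag : X) (v : Fin J → X) : Matrix (Fin J) (Fin J) ℝ :=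
  Matrix.of fun l j => gInner Γ (A (v l - udag)) (A (v j - udag))

/-- The orthogonal complement of a subspace of `ℝ^K` w.r.t. the Γ-weighted inner product. -/
def gOrth {K : ℕ} (Γ : Matrix (Fin K) (Fin K) ℝ)
    (S : Submodule ℝ (EuclideanSpace ℝ (Fin K))) :
    Submodule ℝ (EuclideanSpace ℝ (Fin K)) where
  carrier := {w | ∀ v ∈ S, gInner Γ v w = 0}
  add_mem' := by
    intro a b ha hb v hv
    have h1 := ha v hv
    have h2 := hb v hv
    simp only [gInner, Set.mem_setOf_eq] at *
    rw [inner_add_right, h1, h2, add_zero]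
  zero_mem' := by
    intro v hv
    simp [gInner]
  smul_mem' := by
    intro c a ha v hv
    have h1 := ha v hv
    simp only [gInner, Set.mem_setOf_eq] at *
    rw [inner_smul_right, h1, mul_zero]

/-- The orthogonal complement of a subspace of `X` w.r.t. the inner product
`⟨v,w⟩_* = ⟨A v, A w⟩_Γ`. -/
def gOrthX {X : Type*} [NormedAddCommGroup X] [InnerProductSpace ℝ X] {K : ℕ}
    (A : X →L[ℝ] EuclideanSpace ℝ (Fin K)) (Γ : Matrix (Fin K) (Fin K) ℝ)
    (S : Submodule ℝ X) : Submodule ℝ X where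
  carrier := {w | ∀ v ∈ S, gInner Γ (A v) (A w) = 0}
  add_mem' := by
    intro a b ha hb v hv
    have h1 := ha v hv
    have h2 := hb v hv
    simp only [gInner, Set.mem_setOf_eq, map_add] at *
    rw [inner_add_right, h1, h2, add_zero]
  zero_mem' := by
    intro v hv
    simp [gInner]
  smul_mem' := by
    intro c a ha v hv
    have h1 := ha v hv
    simp only [gInner, Set.mem_setOf_eq, _root_.map_smul] at *
    rw [inner_smul_right, h1, mul_zero]


theorem gInner_comm_aux {K : ℕ} {Γ : Matrix (Fin K) (Fin K) ℝ} (hΓ : Γ.PosDef)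
    (a b : EuclideanSpace ℝ (Fin K)) : gInner Γ a b = gInner Γ b a := by
  have h : (Matrix.toEuclideanLin Γ⁻¹).IsSymmetric :=
    Matrix.isSymmetric_toEuclideanLin_iff.mpr hΓ.isHermitian.inv
  unfold gInner
  rw [h a b, real_inner_comm]

theorem enkf_mapped_residual_energy_identity
    {X : Type*} [NormedAddCommGroup X] [InnerProductSpace ℝ X]
    {K J : ℕ} (hJ : 0 < J)
    (A : X →L[ℝ] EuclideanSpace ℝ (Fin K))
    (Γ : Matrix (Fin K) (Fin K) ℝ) (hΓ : Γ.PosDef)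
    (udag : X) (u : ℝ → Fin J → X)
    (hu : IsEnKFSolution A Γ (A udag) u) :
    ∀ j : Fin J,
      (∀ t ∈ Set.Ici (0 : ℝ),
        HasDerivWithinAt
          (fun s => (1 / 2 : ℝ) * gInner Γ (A (u s j - udag)) (A (u s j - udag)))
          (-((J : ℝ)⁻¹ * ∑ r,
            (gInner Γ (A (u t j - udag)) (A (u t r - ensMean (u t)))) ^ 2))
          (Set.Ici 0) t) ∧
      AntitoneOn
        (fun t => Real.sqrt (gInner Γ (A (u t j - udag)) (A (u t j - udag))))
        (Set.Ici 0) := by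
  intro j
  have key : ∀ t ∈ Set.Ici (0 : ℝ),
        HasDerivWithinAt
          (fun s => (1 / 2 : ℝ) * gInner Γ (A (u s j - udag)) (A (u s j - udag)))
          (-((J : ℝ)⁻¹ * ∑ r,
            (gInner Γ (A (u t j - udag)) (A (u t r - ensMean (u t)))) ^ 2))
          (Set.Ici 0) t := by
    intro t ht
    have h1 := A.hasFDerivAt.comp_hasDerivWithinAt t ((hu j t ht).sub_const udag)
    have h2 := (LinearMap.toContinuousLinearMap
      (Matrix.toEuclideanLin Γ⁻¹)).hasFDerivAt.comp_hasDerivWithinAt t h1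
    have h3 := (h2.inner ℝ h1).const_mul (1 / 2 : ℝ)
    refine h3.congr_deriv ?_
    change (1 / 2 : ℝ) * (gInner Γ (A (u t j - udag)) (A (enkfRHS A Γ (A udag) (u t) j)) +
      gInner Γ (A (enkfRHS A Γ (A udag) (u t) j)) (A (u t j - udag))) = _
    rw [gInner_comm_aux hΓ (A (enkfRHS A Γ (A udag) (u t) j))]
    have h4 : gInner Γ (A (u t j - udag)) (A (enkfRHS A Γ (A udag) (u t) j)) =
        -((J : ℝ)⁻¹ * ∑ r,
            (gInner Γ (A (u t j - udag)) (A (u t r - ensMean (u t)))) ^ 2) := by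
      have h5 : ∀ k, gInner Γ (A (u t k - ensMean (u t))) (A udag - A (u t j)) =
          - gInner Γ (A (u t j - udag)) (A (u t k - ensMean (u t))) := by
        intro k
        rw [gInner_comm_aux hΓ (A (u t j - udag)), ← map_sub, ← neg_sub (u t j) udag, map_neg]
        simp only [gInner, inner_neg_right]
      unfold enkfRHS
      simp only [h5]
      rw [map_smul, map_sum]
      simp only [map_smul]
      unfold gInner
      rw [inner_smul_right, inner_sum, ← mul_neg, ← Finset.sum_neg_distrib]
      congr 1
      refine Finset.sum_congr rfl fun k _ => ?_
      rw [inner_smul_right]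
      ring
    rw [h4]; ring
  refine ⟨key, ?_⟩
  have hanti : AntitoneOn
      (fun s => (1 / 2 : ℝ) * gInner Γ (A (u s j - udag)) (A (u s j - udag))) (Set.Ici 0) := by
    refine antitoneOn_of_hasDerivWithinAt_nonpos (convex_Ici 0)
      (fun t ht => (key t ht).continuousWithinAt)
      (fun t ht => (key t (interior_subset ht)).mono interior_subset) ?_
    intro t _
    have : 0 ≤ (J : ℝ)⁻¹ * ∑ r,
            (gInner Γ (A (u t j - udag)) (A (u t r - ensMean (u t)))) ^ 2 := by positivity
    linarith
  intro s hs t ht hst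
  have := hanti hs ht hst
  apply Real.sqrt_le_sqrt
  simp only at this
  linarith

end
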